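/- (Levelwise uniform approximation of level continuous functions.) Let m > 0 and σ ∈ 𝒜(m), let a < b be reals, and let g⁻, g⁺ : [a,b] → ℝ be continuous functions with g⁻(t) ≤ g⁺(t) for all t ∈ [a,b]. Then for every ε > 0 there exists N ∈ ℕ such that for all integers n ≥ N and all x ∈ [a, b], d_H([S_{n,σ}(g⁻, x), S_{n,σ}(g⁺, x)], [g⁻(x), g⁺(x)]) < ε, where [·,·] denotes a closed interval in ℝ and d_H the Hausdorff distance between subsets of ℝ. -/

import Mathlib

/-- `phi σ m x = σ(x+m) - σ(x-m)`. -/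
noncomputable def phi (σ : ℝ → ℝ) (m : ℝ) (x : ℝ) : ℝ := σ (x + m) - σ (x - m)

/-- The node `x_k = a + k·h` with `h = (b-a)/n`. -/
noncomputable def node (a b : ℝ) (n : ℕ) (k : ℕ) : ℝ := a + k * ((b - a) / n)

/-- The Cardaliaguet–Euvrard neural network operator
`S_{n,σ}(g, x) = ∑_{k=0}^{n} φ((2m/h)(x − x_k)) · g(x_k)`. -/
noncomputable def NN (σ : ℝ → ℝ) (m a b : ℝ) (n : ℕ) (g : ℝ → ℝ) (x : ℝ) : ℝ :=
  ∑ k ∈ Finset.range (n + 1),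
    phi σ m (2 * m / ((b - a) / n) * (x - node a b n k)) * g (node a b n k)

theorem phi_nonneg {σ : ℝ → ℝ} (hσ : Monotone σ) {m : ℝ} (hm : 0 ≤ m) (x : ℝ) :
    0 ≤ phi σ m x :=
  sub_nonneg.2 (hσ (by linarith))

theorem phi_eq_zero_of_two_mul_le_abs {σ : ℝ → ℝ} {m : ℝ} (hm : 0 ≤ m)
    (hσ0 : ∀ x : ℝ, x ≤ -m → σ x = 0) (hσ1 : ∀ x : ℝ, m ≤ x → σ x = 1)
    {x : ℝ} (hx : 2 * m ≤ |x|) : phi σ m x = 0 := by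
  unfold phi
  rcases le_abs.1 hx with h | h
  · rw [hσ1 (x + m) (by linarith), hσ1 (x - m) (by linarith), sub_self]
  · rw [hσ0 (x + m) (by linarith), hσ0 (x - m) (by linarith), sub_self]

theorem sum_range_phi (σ : ℝ → ℝ) (m y : ℝ) (n : ℕ) :
    ∑ k ∈ Finset.range n, phi σ m (y - 2 * m * k) = σ (y + m) - σ (y + m - 2 * m * n) := by
  have h := Finset.sum_range_sub' (fun k : ℕ => σ (y + m - 2 * m * k)) n
  simp only [Nat.cast_zero, mul_zero, sub_zero] at h
  rw [← h]
  refine Finset.sum_congr rfl fun k _ => ?_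
  unfold phi
  push_cast
  congr 2 <;> ring

theorem node_mem_Icc {a b : ℝ} (hab : a ≤ b) {n k : ℕ} (hn : 0 < n) (hk : k ≤ n) :
    node a b n k ∈ Set.Icc a b := by
  have hn' : (0 : ℝ) < n := Nat.cast_pos.2 hn
  have hk' : (k : ℝ) ≤ n := Nat.cast_le.2 hk
  have hh : 0 ≤ (b - a) / n := div_nonneg (sub_nonneg.2 hab) hn'.le
  have hb : (n : ℝ) * ((b - a) / n) = b - a := mul_div_cancel₀ _ hn'.ne'
  have h0 : 0 ≤ (k : ℝ) * ((b - a) / n) := by positivity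
  have h1 := mul_le_mul_of_nonneg_right hk' hh
  unfold node
  constructor <;> linarith

/-- The weights of the operator form a partition of unity on `[a, b]`. -/
theorem sum_phi_node {σ : ℝ → ℝ} {m : ℝ} (hm : 0 ≤ m)
    (hσ0 : ∀ x : ℝ, x ≤ -m → σ x = 0) (hσ1 : ∀ x : ℝ, m ≤ x → σ x = 1)
    {a b : ℝ} (hab : a < b) {n : ℕ} (hn : 0 < n) {x : ℝ} (hx : x ∈ Set.Icc a b) :
    ∑ k ∈ Finset.range (n + 1), phi σ m (2 * m / ((b - a) / n) * (x - node a b n k)) = 1 := by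
  have hn' : (0 : ℝ) < n := Nat.cast_pos.2 hn
  have hba : 0 < b - a := sub_pos.2 hab
  set y : ℝ := 2 * m / ((b - a) / n) * (x - a) with hy
  have hy0 : 0 ≤ y := mul_nonneg (by positivity) (sub_nonneg.2 hx.1)
  have hy1 : y ≤ 2 * m * n := by
    calc y ≤ 2 * m / ((b - a) / n) * (b - a) :=
          mul_le_mul_of_nonneg_left (by linarith [hx.2]) (by positivity)
      _ = 2 * m * n := by field_simp
  have hsum : ∑ k ∈ Finset.range (n + 1),
      phi σ m (2 * m / ((b - a) / n) * (x - node a b n k)) =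
      ∑ k ∈ Finset.range (n + 1), phi σ m (y - 2 * m * k) := by
    refine Finset.sum_congr rfl fun k _ => congrArg _ ?_
    rw [hy, node]
    field_simp
    ring
  rw [hsum, sum_range_phi, hσ1 _ (by linarith), hσ0 _ (by push_cast; linarith), sub_zero]

theorem abs_NN_sub_le {σ : ℝ → ℝ} {m : ℝ} (hm : 0 < m) (hσ : Monotone σ)
    (hσ0 : ∀ x : ℝ, x ≤ -m → σ x = 0) (hσ1 : ∀ x : ℝ, m ≤ x → σ x = 1)
    {a b : ℝ} (hab : a < b) {n : ℕ} (hn : 0 < n) {g : ℝ → ℝ} {x ε : ℝ} (hx : x ∈ Set.Icc a b)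
    (hg : ∀ t ∈ Set.Icc a b, |x - t| < (b - a) / n → |g t - g x| ≤ ε) :
    |NN σ m a b n g x - g x| ≤ ε := by
  have hh : 0 < (b - a) / n := div_pos (sub_pos.2 hab) (Nat.cast_pos.2 hn)
  have h1 := sum_phi_node hm.le hσ0 hσ1 hab hn hx
  set w : ℕ → ℝ := fun k => phi σ m (2 * m / ((b - a) / n) * (x - node a b n k)) with hw
  have hw0 : ∀ k, 0 ≤ w k := fun k => phi_nonneg hσ hm.le _
  have hterm : ∀ k ∈ Finset.range (n + 1), |w k * (g (node a b n k) - g x)| ≤ w k * ε := by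
    intro k hk
    rw [abs_mul, abs_of_nonneg (hw0 k)]
    by_cases hd : |x - node a b n k| < (b - a) / n
    · exact mul_le_mul_of_nonneg_left
        (hg _ (node_mem_Icc hab.le hn (Nat.lt_succ_iff.1 (Finset.mem_range.1 hk))) hd) (hw0 k)
    · have hwk : w k = 0 := by
        refine phi_eq_zero_of_two_mul_le_abs hm.le hσ0 hσ1 ?_
        rw [abs_mul, abs_of_pos (by positivity)]
        calc 2 * m = 2 * m / ((b - a) / n) * ((b - a) / n) := (div_mul_cancel₀ _ hh.ne').symm
          _ ≤ _ := mul_le_mul_of_nonneg_left (not_lt.1 hd) (by positivity)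
      simp [hwk]
  calc |NN σ m a b n g x - g x|
      = |∑ k ∈ Finset.range (n + 1), w k * (g (node a b n k) - g x)| := by
        simp only [mul_sub, Finset.sum_sub_distrib, ← Finset.sum_mul]
        rw [h1, one_mul]
        rfl
    _ ≤ ∑ k ∈ Finset.range (n + 1), w k * ε :=
        (Finset.abs_sum_le_sum_abs _ _).trans (Finset.sum_le_sum hterm)
    _ = ε := by rw [← Finset.sum_mul, h1, one_mul]

/-- The operators `NN σ m a b n g` converge to `g` uniformly on `[a, b]`. -/
theorem eventually_abs_NN_sub_le {σ : ℝ → ℝ} {m : ℝ} (hm : 0 < m) (hσ : Monotone σ)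
    (hσ0 : ∀ x : ℝ, x ≤ -m → σ x = 0) (hσ1 : ∀ x : ℝ, m ≤ x → σ x = 1)
    {a b : ℝ} (hab : a < b) {g : ℝ → ℝ} (hg : ContinuousOn g (Set.Icc a b))
    {ε : ℝ} (hε : 0 < ε) :
    ∀ᶠ n : ℕ in Filter.atTop, ∀ x ∈ Set.Icc a b, |NN σ m a b n g x - g x| ≤ ε := by
  obtain ⟨δ, hδ, H⟩ := Metric.uniformContinuousOn_iff.1
    (isCompact_Icc.uniformContinuousOn_of_continuous hg) ε hε
  filter_upwards [(tendsto_const_div_atTop_nhds_zero_nat (b - a)).eventually (gt_mem_nhds hδ),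
    Filter.eventually_gt_atTop 0] with n hnδ hn x hx
  refine abs_NN_sub_le hm hσ hσ0 hσ1 hab hn hx fun t ht htx => ?_
  refine (H t ht x hx ?_).le
  rw [Real.dist_eq, abs_sub_comm]
  exact htx.trans hnδ

theorem NN_mono {σ : ℝ → ℝ} {m : ℝ} (hm : 0 ≤ m) (hσ : Monotone σ) {a b : ℝ} (hab : a ≤ b)
    {n : ℕ} (hn : 0 < n) {f g : ℝ → ℝ} (hfg : ∀ t ∈ Set.Icc a b, f t ≤ g t) (x : ℝ) :
    NN σ m a b n f x ≤ NN σ m a b n g x :=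
  Finset.sum_le_sum fun _ hk => mul_le_mul_of_nonneg_left
    (hfg _ (node_mem_Icc hab hn (Nat.lt_succ_iff.1 (Finset.mem_range.1 hk))))
    (phi_nonneg hσ hm _)

theorem exists_mem_Icc_dist_le {p q r s δ x : ℝ} (hrs : r ≤ s) (hpr : |p - r| ≤ δ)
    (hqs : |q - s| ≤ δ) (hx : x ∈ Set.Icc p q) : ∃ y ∈ Set.Icc r s, dist x y ≤ δ := by
  obtain ⟨hpx, hxq⟩ := hx
  rw [abs_le] at hpr hqs
  simp only [Real.dist_eq, abs_le]
  rcases le_total x r with h | h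
  · exact ⟨r, ⟨le_rfl, hrs⟩, by linarith, by linarith⟩
  rcases le_total x s with h' | h'
  · exact ⟨x, ⟨h, h'⟩, by linarith, by linarith⟩
  · exact ⟨s, ⟨hrs, le_rfl⟩, by linarith, by linarith⟩

theorem hausdorffDist_Icc_le {p q r s δ : ℝ} (hpq : p ≤ q) (hrs : r ≤ s) (hpr : |p - r| ≤ δ)
    (hqs : |q - s| ≤ δ) : Metric.hausdorffDist (Set.Icc p q) (Set.Icc r s) ≤ δ :=
  Metric.hausdorffDist_le_of_mem_dist ((abs_nonneg _).trans hpr)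
    (fun _ hx => exists_mem_Icc_dist_le hrs hpr hqs hx)
    (fun _ hx => exists_mem_Icc_dist_le hpq (abs_sub_comm p r ▸ hpr) (abs_sub_comm q s ▸ hqs) hx)

/-- Levelwise uniform approximation of level continuous functions: if `g⁻, g⁺` are
continuous on `[a,b]` with `g⁻ ≤ g⁺`, then for every `ε > 0` there is `N` such that for
all `n ≥ N` and all `x ∈ [a,b]` the Hausdorff distance between
`[S_{n,σ}(g⁻, x), S_{n,σ}(g⁺, x)]` and `[g⁻(x), g⁺(x)]` is less than `ε`. -/
theorem stmt6 (m : ℝ) (hm : 0 < m) (σ : ℝ → ℝ)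
    (hσ_mono : Monotone σ)
    (hσ0 : ∀ x : ℝ, x ≤ -m → σ x = 0)
    (hσ1 : ∀ x : ℝ, m ≤ x → σ x = 1)
    (a b : ℝ) (hab : a < b)
    (glo ghi : ℝ → ℝ) (hle : ∀ t ∈ Set.Icc a b, glo t ≤ ghi t)
    (hclo : ContinuousOn glo (Set.Icc a b)) (hchi : ContinuousOn ghi (Set.Icc a b)) :
    ∀ ε > (0:ℝ), ∃ N : ℕ, ∀ n : ℕ, N ≤ n → ∀ x ∈ Set.Icc a b,
      Metric.hausdorffDist (Set.Icc (NN σ m a b n glo x) (NN σ m a b n ghi x))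
        (Set.Icc (glo x) (ghi x)) < ε := by
  intro ε hε
  refine Filter.eventually_atTop.1 ?_
  filter_upwards [eventually_abs_NN_sub_le hm hσ_mono hσ0 hσ1 hab hclo (half_pos hε),
    eventually_abs_NN_sub_le hm hσ_mono hσ0 hσ1 hab hchi (half_pos hε),
    Filter.eventually_gt_atTop 0] with n hlo hhi hn x hx
  exact (hausdorffDist_Icc_le (NN_mono hm.le hσ_mono hab.le hn hle x) (hle x hx)
    (hlo x hx) (hhi x hx)).trans_lt (half_lt_self hε)
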